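/- Let k ≥ 3 and 1 ≤ n₁ ≤ ⋯ ≤ n_k. The 4-secant variety of the Segre variety P^{n₁} × ⋯ × P^{n_k} is non-defective, i.e. T(n₁,…,n_k; 4; 0,…,0) holds, unless (n₁,…,n_k) = (1,2,a) with a ≥ 4 or (n₁,…,n_k) = (2,2,2); in these exceptional cases T(n₁,…,n_k; 4; 0,…,0) fails. -/

import Mathlib

open scoped TensorProduct

/-- The subspace `G^i_p = v₁ ⊗ ⋯ ⊗ v_{i-1} ⊗ Vᵢ ⊗ v_{i+1} ⊗ ⋯ ⊗ v_k` of the tensor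
space `⨂ᵢ K^{nᵢ+1}` attached to the point `p = v₁ ⊗ ⋯ ⊗ v_k`. -/
noncomputable def segreG (K : Type*) [Field K] {k : ℕ} (n : Fin k → ℕ)
    (v : ∀ i, Fin (n i + 1) → K) (i : Fin k) :
    Submodule K (⨂[K] i, (Fin (n i + 1) → K)) :=
  LinearMap.range ((PiTensorProduct.tprod K).toLinearMap v i)

/-- The affine tangent space `T_p = Σᵢ v₁ ⊗ ⋯ ⊗ Vᵢ ⊗ ⋯ ⊗ v_k` to the Segre variety at
`p = v₁ ⊗ ⋯ ⊗ v_k`. -/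
noncomputable def segreTangent (K : Type*) [Field K] {k : ℕ} (n : Fin k → ℕ)
    (v : ∀ i, Fin (n i + 1) → K) : Submodule K (⨂[K] i, (Fin (n i + 1) → K)) :=
  ⨆ i, segreG K n v i

/-- The statement `T(n₁,…,n_k; s; a₁,…,a_k)` of Abo–Ottaviani–Peterson holds:
there are points `p₁,…,p_s` and `q_{i,1},…,q_{i,aᵢ}` (pure tensors of nonzero vectors)
such that the span of the tangent spaces `T_{p_j}` together with the subspaces
`G^i_{q_{i,l}}` has the expected (maximal possible) dimension
`min (s(1 + Σ nᵢ) + Σ aᵢ(nᵢ+1)) (Π (nᵢ+1))`. -/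
def THolds (K : Type*) [Field K] {k : ℕ} (n : Fin k → ℕ) (s : ℕ) (a : Fin k → ℕ) : Prop :=
  ∃ (p : Fin s → ∀ i, Fin (n i + 1) → K)
    (q : ∀ i : Fin k, Fin (a i) → ∀ j, Fin (n j + 1) → K),
    (∀ j i, p j i ≠ 0) ∧ (∀ i l j, q i l j ≠ 0) ∧
    Module.finrank K
      (((⨆ j, segreTangent K n (p j)) ⊔ (⨆ i, ⨆ l, segreG K n (q i l) i))
        : Submodule K (⨂[K] i, (Fin (n i + 1) → K)))
      = min (s * (1 + ∑ i, n i) + ∑ i, a i * (n i + 1)) (∏ i, (n i + 1))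

/-- The statement `T(n₁,…,n_k; s; a₁,…,a_k)` fails: every choice of points gives a span
of dimension strictly smaller than the expected dimension. -/
def TFails (K : Type*) [Field K] {k : ℕ} (n : Fin k → ℕ) (s : ℕ) (a : Fin k → ℕ) : Prop :=
  ∀ (p : Fin s → ∀ i, Fin (n i + 1) → K)
    (q : ∀ i : Fin k, Fin (a i) → ∀ j, Fin (n j + 1) → K),
    (∀ j i, p j i ≠ 0) → (∀ i l j, q i l j ≠ 0) →
    Module.finrank K
      (((⨆ j, segreTangent K n (p j)) ⊔ (⨆ i, ⨆ l, segreG K n (q i l) i))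
        : Submodule K (⨂[K] i, (Fin (n i + 1) → K)))
      < min (s * (1 + ∑ i, n i) + ∑ i, a i * (n i + 1)) (∏ i, (n i + 1))

/-- The tuple `(n; s; a)` is subabundant. -/
def Subabundant {k : ℕ} (n : Fin k → ℕ) (s : ℕ) (a : Fin k → ℕ) : Prop :=
  s * (1 + ∑ i, n i) + ∑ i, a i * (n i + 1) ≤ ∏ i, (n i + 1)

/-- The tuple `(n; s; a)` is superabundant. -/
def Superabundant {k : ℕ} (n : Fin k → ℕ) (s : ℕ) (a : Fin k → ℕ) : Prop :=
  ∏ i, (n i + 1) ≤ s * (1 + ∑ i, n i) + ∑ i, a i * (n i + 1)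

section Segre

variable {K : Type*} [Field K] {k : ℕ}

/-- The monomial basis of the tensor space. -/
noncomputable def segreBasis (K : Type*) [Field K] {k : ℕ} (n : Fin k → ℕ) :
    Module.Basis (∀ i, Fin (n i + 1)) K (⨂[K] i, (Fin (n i + 1) → K)) :=
  Basis.piTensorProduct fun i => Pi.basisFun K (Fin (n i + 1))

lemma segreBasis_repr_tprod (n : Fin k → ℕ) (v : ∀ i, Fin (n i + 1) → K)
    (I : ∀ i, Fin (n i + 1)) :
    (segreBasis K n).repr (PiTensorProduct.tprod K v) I = ∏ i, v i (I i) := by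
  simp [segreBasis]

lemma segreBasis_apply (n : Fin k → ℕ) (I : ∀ i, Fin (n i + 1)) :
    segreBasis K n I = PiTensorProduct.tprod K fun i => Pi.single (I i) (1 : K) := by
  simp [segreBasis]

lemma finrank_tensor (n : Fin k → ℕ) :
    Module.finrank K (⨂[K] i, (Fin (n i + 1) → K)) = ∏ i, (n i + 1) := by
  rw [Module.finrank_eq_card_basis (segreBasis K n)]
  simp

lemma tprod_update_mem_segreG (n : Fin k → ℕ) (v : ∀ i, Fin (n i + 1) → K) (i : Fin k)
    (x : Fin (n i + 1) → K) :
    PiTensorProduct.tprod K (Function.update v i x) ∈ segreG K n v i :=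
  ⟨x, rfl⟩

lemma tprod_update_mem_iSup {s : ℕ} (n : Fin k → ℕ) (p : Fin s → ∀ i, Fin (n i + 1) → K)
    (j : Fin s) (i : Fin k) (x : Fin (n i + 1) → K) :
    PiTensorProduct.tprod K (Function.update (p j) i x) ∈ ⨆ j, segreTangent K n (p j) :=
  Submodule.mem_iSup_of_mem j
    (Submodule.mem_iSup_of_mem i (tprod_update_mem_segreG n (p j) i x))

lemma iSup_segreTangent_le_iff {s : ℕ} (n : Fin k → ℕ) (p : Fin s → ∀ i, Fin (n i + 1) → K)
    (S : Submodule K (⨂[K] i, (Fin (n i + 1) → K))) :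
    ⨆ j, segreTangent K n (p j) ≤ S ↔
      ∀ j i x, PiTensorProduct.tprod K (Function.update (p j) i x) ∈ S := by
  simp only [segreTangent, segreG, iSup_le_iff, LinearMap.range_le_iff_comap,
    Submodule.eq_top_iff', Submodule.mem_comap]
  rfl

lemma tangent_sup_empty {s : ℕ} (n : Fin k → ℕ) (p : Fin s → ∀ i, Fin (n i + 1) → K)
    (q : ∀ _ : Fin k, Fin 0 → ∀ j, Fin (n j + 1) → K) :
    (⨆ j, segreTangent K n (p j)) ⊔ (⨆ i, ⨆ l, segreG K n (q i l) i) =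
      ⨆ j, segreTangent K n (p j) := by
  simp only [iSup_of_empty, iSup_bot, sup_bot_eq]

lemma tHolds_of_finrank_eq {n : Fin k → ℕ} {s : ℕ} (p : Fin s → ∀ i, Fin (n i + 1) → K)
    (hp : ∀ j i, p j i ≠ 0)
    (h : Module.finrank K ↥(⨆ j, segreTangent K n (p j)) =
      min (s * (1 + ∑ i, n i)) (∏ i, (n i + 1))) : THolds K n s (fun _ => 0) := by
  refine ⟨p, fun _ l => l.elim0, hp, fun _ l => l.elim0, ?_⟩
  rw [tangent_sup_empty, h]
  simp

lemma tFails_of_finrank_lt {n : Fin k → ℕ} {s : ℕ}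
    (h : ∀ p : Fin s → ∀ i, Fin (n i + 1) → K, (∀ j i, p j i ≠ 0) →
      Module.finrank K ↥(⨆ j, segreTangent K n (p j)) <
        min (s * (1 + ∑ i, n i)) (∏ i, (n i + 1))) : TFails K n s (fun _ => 0) := by
  intro p q hp _
  rw [tangent_sup_empty]
  simpa using h p hp

lemma tHolds_of_iSup_eq_top {n : Fin k → ℕ} {s : ℕ} (p : Fin s → ∀ i, Fin (n i + 1) → K)
    (hp : ∀ j i, p j i ≠ 0) (hn : ∏ i, (n i + 1) ≤ s * (1 + ∑ i, n i))
    (h : ⨆ j, segreTangent K n (p j) = ⊤) : THolds K n s (fun _ => 0) :=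
  tHolds_of_finrank_eq p hp (by rw [h, finrank_top, finrank_tensor, min_eq_right hn])

/-- Parametrization of the sum of the tangent spaces at `p₁, …, p_s`, where the `i`-th tangent
direction at `p_j` is normalized to vanish at the coordinate `m j i`. -/
noncomputable def tangentParam {s : ℕ} (n : Fin k → ℕ) (p : Fin s → ∀ i, Fin (n i + 1) → K)
    (m : Fin s → ∀ i, Fin (n i + 1)) :
    (∀ j : Fin s, K × (∀ i : Fin k,
      LinearMap.ker (LinearMap.proj (R := K) (φ := fun _ : Fin (n i + 1) => K) (m j i)))) →ₗ[K]
      ⨂[K] i, (Fin (n i + 1) → K) :=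
  ∑ j, ((LinearMap.toSpanSingleton K _ (PiTensorProduct.tprod K (p j))).coprod
      (∑ i, (PiTensorProduct.tprod K).toLinearMap (p j) i ∘ₗ Submodule.subtype _ ∘ₗ
        LinearMap.proj i)) ∘ₗ LinearMap.proj j

lemma tangentParam_apply {s : ℕ} (n : Fin k → ℕ) (p : Fin s → ∀ i, Fin (n i + 1) → K)
    (m : Fin s → ∀ i, Fin (n i + 1))
    (x : ∀ j : Fin s, K × (∀ i : Fin k,
      LinearMap.ker (LinearMap.proj (R := K) (φ := fun _ : Fin (n i + 1) => K) (m j i)))) :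
    tangentParam n p m x = ∑ j, ((x j).1 • PiTensorProduct.tprod K (p j) +
      ∑ i, PiTensorProduct.tprod K (Function.update (p j) i ((x j).2 i))) := by
  simp [tangentParam]

lemma range_tangentParam {s : ℕ} (n : Fin k → ℕ) (p : Fin s → ∀ i, Fin (n i + 1) → K)
    (m : Fin s → ∀ i, Fin (n i + 1)) (hm : ∀ j i, p j i (m j i) ≠ 0) (hk : 0 < k) :
    LinearMap.range (tangentParam n p m) = ⨆ j, segreTangent K n (p j) := by
  apply le_antisymm
  · rintro _ ⟨x, rfl⟩
    rw [tangentParam_apply]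
    refine Submodule.sum_mem _ fun j _ => Submodule.add_mem _ (Submodule.smul_mem _ _ ?_)
      (Submodule.sum_mem _ fun i _ => tprod_update_mem_iSup n p j i _)
    simpa using tprod_update_mem_iSup n p j ⟨0, hk⟩ (p j ⟨0, hk⟩)
  · rw [iSup_segreTangent_le_iff]
    intro j i x
    set c := x (m j i) / p j i (m j i)
    have hker : x - c • p j i ∈
        LinearMap.ker (LinearMap.proj (R := K) (φ := fun _ : Fin (n i + 1) => K) (m j i)) := by
      simp [c, hm j i]
    refine ⟨Pi.single j (c, Pi.single i ⟨_, hker⟩), ?_⟩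
    rw [tangentParam_apply, Finset.sum_eq_single j, Finset.sum_eq_single i]
    · simp
    · intro i' _ hi'
      simp only [Pi.single_eq_same, Pi.single_eq_of_ne hi', ZeroMemClass.coe_zero]
      exact MultilinearMap.map_coord_zero _ i' (by simp)
    · simp
    · intro j' _ hj'
      simp only [Pi.single_eq_of_ne hj', Prod.fst_zero, zero_smul, Prod.snd_zero, zero_add]
      exact Finset.sum_eq_zero fun i' _ => MultilinearMap.map_coord_zero _ i' (by simp)
    · simp

lemma finrank_tangentParam_domain {s : ℕ} (n : Fin k → ℕ) (m : Fin s → ∀ i, Fin (n i + 1)) :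
    Module.finrank K (∀ j : Fin s, K × (∀ i : Fin k,
      LinearMap.ker (LinearMap.proj (R := K) (φ := fun _ : Fin (n i + 1) => K) (m j i)))) =
      s * (1 + ∑ i, n i) := by
  have h (j : Fin s) (i : Fin k) : Module.finrank K
      (LinearMap.ker (LinearMap.proj (R := K) (φ := fun _ : Fin (n i + 1) => K) (m j i))) =
        n i := by
    have := LinearMap.finrank_range_add_finrank_ker
      (LinearMap.proj (R := K) (φ := fun _ : Fin (n i + 1) => K) (m j i))
    rw [LinearMap.range_eq_top.2 (LinearMap.proj_surjective _)] at this
    simp at this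
    omega
  simp [Module.finrank_pi_fintype, Module.finrank_prod, h]

/-- The tangent spaces at the points with coordinates `v j i t` are independent as soon as the
normalized parametrization of their sum is injective. -/
lemma tHolds_of_independent {s : ℕ} (hk : 0 < k) (n : Fin k → ℕ) (v : Fin s → Fin k → ℕ → K)
    (m : Fin s → Fin k → ℕ) (hmn : ∀ j i, m j i ≤ n i) (hv : ∀ j i, v j i (m j i) ≠ 0)
    (h : ∀ (r : Fin s → K) (c : Fin s → Fin k → ℕ → K), (∀ j i, c j i (m j i) = 0) →
      (∀ I : Fin k → ℕ, (∀ i, I i ≤ n i) → ∑ j, (r j * ∏ i, v j i (I i) +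
        ∑ i, ∏ l, Function.update (fun l => v j l (I l)) i (c j i (I i)) l) = 0) →
      ∀ j, r j = 0 ∧ ∀ i, ∀ t ≤ n i, c j i t = 0) :
    THolds K n s (fun _ => 0) := by
  set p : Fin s → ∀ i, Fin (n i + 1) → K := fun j i t => v j i t with hp
  set m' : Fin s → ∀ i, Fin (n i + 1) := fun j i => ⟨m j i, Nat.lt_succ_of_le (hmn j i)⟩ with hm'
  have hpm (j i) : p j i (m' j i) ≠ 0 := hv j i
  have hinj : Function.Injective (tangentParam n p m') := by
    rw [← LinearMap.ker_eq_bot, LinearMap.ker_eq_bot']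
    intro x hx
    rw [tangentParam_apply] at hx
    have key := h (fun j => (x j).1)
      (fun j i t => if ht : t < n i + 1 then ((x j).2 i : Fin (n i + 1) → K) ⟨t, ht⟩ else 0) ?_ ?_
    · funext j
      obtain ⟨h1, h2⟩ := key j
      refine Prod.ext h1 (funext fun i => Subtype.ext (funext fun t => ?_))
      simpa [t.2] using h2 i t (Nat.le_of_lt_succ t.2)
    · intro j i
      have := ((x j).2 i).2
      rw [LinearMap.mem_ker] at this
      rw [dif_pos (Nat.lt_succ_of_le (hmn j i))]
      exact this
    · intro I hI
      have := congrArg (fun y => (segreBasis K n).repr y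
        fun i => ⟨I i, Nat.lt_succ_of_le (hI i)⟩) hx
      simp only [map_sum, map_add, map_smul, map_zero, Finsupp.coe_finsetSum, Finset.sum_apply,
        Finsupp.add_apply, Finsupp.smul_apply, segreBasis_repr_tprod, Finsupp.zero_apply,
        smul_eq_mul] at this
      rw [← this]
      refine Finset.sum_congr rfl fun j _ => ?_
      refine congrArg₂ _ rfl (Finset.sum_congr rfl fun i _ => Finset.prod_congr rfl fun l _ => ?_)
      rcases eq_or_ne l i with rfl | hl
      · simp [Nat.lt_succ_of_le (hI l)]
      · simp [hl, hp]
  have hfin : Module.finrank K ↥(⨆ j, segreTangent K n (p j)) = s * (1 + ∑ i, n i) := by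
    rw [← range_tangentParam n p m' hpm hk, LinearMap.finrank_range_of_inj hinj,
      finrank_tangentParam_domain]
  refine tHolds_of_finrank_eq p (fun j i h0 => hpm j i (by simp [h0])) ?_
  rw [hfin, min_eq_left]
  rw [← hfin, ← finrank_tensor (K := K)]
  exact Submodule.finrank_le _

/-- Coordinate points whose indices pairwise differ in at least three places. -/
lemma tHolds_of_code {s : ℕ} (hk : 0 < k) (n : Fin k → ℕ) (w : Fin s → Fin k → ℕ)
    (hw : ∀ j i, w j i ≤ n i)
    (hd : ∀ j j', j' ≠ j → ∀ i i', ∃ l, l ≠ i ∧ l ≠ i' ∧ w j l ≠ w j' l) :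
    THolds K n s (fun _ => 0) := by
  refine tHolds_of_independent hk n (fun j i t => if t = w j i then 1 else 0) w hw (by simp) ?_
  intro r c hc hI
  have key (j : Fin s) (i : Fin k) (t : ℕ) (ht : t ≤ n i) :
      r j * (if t = w j i then 1 else 0) + c j i t = 0 := by
    have := hI (Function.update (w j) i t) (fun l => by
      rcases eq_or_ne l i with rfl | hl
      · simpa using ht
      · simpa [hl] using hw j l)
    rw [Finset.sum_eq_single j, Finset.sum_eq_single i, Finset.prod_eq_single i,
      Finset.prod_eq_single i] at this
    · simpa using this
    · intro l _ hl
      simp [hl]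
    · simp
    · intro l _ hl
      simp [hl]
    · simp
    · intro i' _ hi'
      exact Finset.prod_eq_zero (Finset.mem_univ i') (by simp [hi', hc])
    · simp
    · intro j' _ hj'
      have hz (i' : Fin k) : ∃ l, l ≠ i' ∧ ¬ Function.update (w j) i t l = w j' l := by
        obtain ⟨l, hl, hl', h⟩ := hd j j' hj' i i'
        exact ⟨l, hl', by simpa [hl] using h⟩
      rw [Finset.prod_eq_zero (Finset.mem_univ (hz i).choose)
        (if_neg (hz i).choose_spec.2), mul_zero, zero_add]
      refine Finset.sum_eq_zero fun i' _ => ?_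
      obtain ⟨l, hl, h⟩ := hz i'
      exact Finset.prod_eq_zero (Finset.mem_univ l) (by simp [hl, h])
    · simp
  have hr (j : Fin s) : r j = 0 := by simpa [hc] using key j ⟨0, hk⟩ _ (hw j ⟨0, hk⟩)
  exact fun j => ⟨hr j, fun i t ht => by simpa [hr] using key j i t ht⟩

/-- Coordinate points such that every index differs from one of theirs in at most one place. -/
lemma tHolds_of_cover {s : ℕ} (n : Fin k → ℕ) (w : Fin s → Fin k → ℕ)
    (hw : ∀ j i, w j i ≤ n i) (hn : ∏ i, (n i + 1) ≤ s * (1 + ∑ i, n i))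
    (hc : ∀ I : Fin k → ℕ, (∀ i, I i ≤ n i) → ∃ j i, ∀ l, l ≠ i → I l = w j l) :
    THolds K n s (fun _ => 0) := by
  refine tHolds_of_iSup_eq_top
    (fun j i => Pi.single ⟨w j i, Nat.lt_succ_of_le (hw j i)⟩ 1) (fun j i => ?_) hn ?_
  · simp
  rw [eq_top_iff, ← (segreBasis K n).span_eq, Submodule.span_le]
  rintro _ ⟨I, rfl⟩
  obtain ⟨j, i, h⟩ := hc (fun i => I i) (fun i => Nat.le_of_lt_succ (I i).2)
  rw [SetLike.mem_coe, segreBasis_apply]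
  convert tprod_update_mem_iSup (K := K) n
    (fun j i => Pi.single ⟨w j i, Nat.lt_succ_of_le (hw j i)⟩ 1) j i (Pi.single (I i) 1) using 2
  funext l
  rcases eq_or_ne l i with rfl | hl
  · simp
  · rw [Function.update_of_ne hl]
    congr 1
    exact Fin.ext (h l hl)

lemma tHolds_four_of_five_le (hk : 5 ≤ k) (n : Fin k → ℕ) (hpos : ∀ i, 1 ≤ n i) :
    THolds K n 4 (fun _ => 0) := by
  have hcode : ∀ j j' : Fin 4, j' ≠ j → ∃ l₁ l₂ l₃ : Fin 5, l₁ ≠ l₂ ∧ l₁ ≠ l₃ ∧ l₂ ≠ l₃ ∧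
      ∀ l ∈ [l₁, l₂, l₃],
        (![![0, 0, 0, 0, 0], ![1, 1, 1, 0, 0], ![0, 0, 1, 1, 1], ![1, 1, 0, 1, 1]] :
          Fin 4 → Fin 5 → ℕ) j l ≠
        (![![0, 0, 0, 0, 0], ![1, 1, 1, 0, 0], ![0, 0, 1, 1, 1], ![1, 1, 0, 1, 1]] :
          Fin 4 → Fin 5 → ℕ) j' l := by
    decide
  have hle : ∀ (j : Fin 4) (l : Fin 5),
      (![![0, 0, 0, 0, 0], ![1, 1, 1, 0, 0], ![0, 0, 1, 1, 1], ![1, 1, 0, 1, 1]] :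
        Fin 4 → Fin 5 → ℕ) j l ≤ 1 := by
    decide
  generalize (![![0, 0, 0, 0, 0], ![1, 1, 1, 0, 0], ![0, 0, 1, 1, 1], ![1, 1, 0, 1, 1]] :
    Fin 4 → Fin 5 → ℕ) = w at hcode hle
  refine tHolds_of_code (by omega) n
    (fun j i => if h : i.1 < 5 then w j ⟨i, h⟩ else 0) (fun j i => ?_) ?_
  · split_ifs with h
    · exact (hle j _).trans (hpos i)
    · exact Nat.zero_le _
  · intro j j' hj i i'
    obtain ⟨l₁, l₂, l₃, h₁₂, h₁₃, h₂₃, hl⟩ := hcode j j' hj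
    obtain ⟨l, hmem, h, h'⟩ : ∃ l ∈ [l₁, l₂, l₃], l.1 ≠ i.1 ∧ l.1 ≠ i'.1 := by
      simp only [ne_eq, Fin.ext_iff] at h₁₂ h₁₃ h₂₃
      by_contra! hcon
      have a₁ := hcon l₁ (by simp)
      have a₂ := hcon l₂ (by simp)
      have a₃ := hcon l₃ (by simp)
      omega
    refine ⟨Fin.castLE hk l, fun e => h (by simp [← e]), fun e => h' (by simp [← e]), ?_⟩
    simpa using hl l hmem

lemma tHolds_four_of_one_one_two_two (n : Fin 4 → ℕ) (h0 : 1 ≤ n 0) (h1 : 1 ≤ n 1)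
    (h2 : 2 ≤ n 2) (h3 : 2 ≤ n 3) : THolds K n 4 (fun _ => 0) := by
  refine tHolds_of_code (by omega) n
    ![![0, 0, 0, 0], ![1, 1, 0, 1], ![0, 1, 1, 2], ![1, 0, 2, 2]] ?_ (by decide)
  intro j i
  fin_cases i <;> fin_cases j <;> simp <;> omega

lemma tHolds_four_of_one_one_one_three (n : Fin 4 → ℕ) (h0 : 1 ≤ n 0) (h1 : 1 ≤ n 1)
    (h2 : 1 ≤ n 2) (h3 : 3 ≤ n 3) : THolds K n 4 (fun _ => 0) := by
  refine tHolds_of_code (by omega) n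
    ![![0, 0, 0, 0], ![0, 1, 1, 1], ![1, 0, 1, 2], ![1, 1, 0, 3]] ?_ (by decide)
  intro j i
  fin_cases i <;> fin_cases j <;> simp <;> omega

lemma tHolds_four_one_one_one_one (n : Fin 4 → ℕ) (h0 : n 0 = 1) (h1 : n 1 = 1)
    (h2 : n 2 = 1) (h3 : n 3 = 1) : THolds K n 4 (fun _ => 0) := by
  refine tHolds_of_cover n ![![0, 0, 0, 0], ![0, 1, 1, 1], ![1, 0, 0, 0], ![1, 1, 1, 1]] ?_
    (by simp [Fin.prod_univ_four, Fin.sum_univ_four, h0, h1, h2, h3]) ?_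
  · intro j i
    fin_cases i <;> fin_cases j <;> simp [*]
  · intro I hI
    have hI' : ∀ i, I i < 2 := by
      intro i
      have := hI i
      fin_cases i <;> simp_all
    have hdec : ∀ J : Fin 4 → Fin 2, ∃ (j i : Fin 4), ∀ l, l ≠ i → (J l : ℕ) =
        ![![0, 0, 0, 0], ![0, 1, 1, 1], ![1, 0, 0, 0], ![1, 1, 1, 1]] j l := by
      decide
    exact hdec fun i => ⟨I i, hI' i⟩

lemma tHolds_four_one_two_two (n : Fin 3 → ℕ) (h0 : n 0 = 1) (h1 : n 1 = 2)
    (h2 : n 2 = 2) : THolds K n 4 (fun _ => 0) := by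
  refine tHolds_of_cover n ![![0, 0, 0], ![0, 1, 1], ![1, 2, 2], ![1, 0, 0]] ?_
    (by simp [Fin.prod_univ_three, Fin.sum_univ_three, h0, h1, h2]) ?_
  · intro j i
    fin_cases i <;> fin_cases j <;> simp [*]
  · intro I hI
    have b0 := hI 0
    have b1 := hI 1
    have b2 := hI 2
    rw [h0] at b0
    rw [h1] at b1
    rw [h2] at b2
    simp only [Fin.exists_fin_succ, Fin.forall_fin_succ]
    simp
    omega

lemma tHolds_four_one_one (n : Fin 3 → ℕ) (h0 : n 0 = 1) (h1 : n 1 = 1) :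
    THolds K n 4 (fun _ => 0) := by
  refine tHolds_of_cover n ![![0, 0, 0], ![0, 1, 0], ![1, 0, 0], ![1, 1, 0]] ?_ ?_ ?_
  · intro j i
    fin_cases i <;> fin_cases j <;> simp [*]
  · simp only [Fin.prod_univ_three, Fin.sum_univ_three, h0, h1]
    omega
  · intro I hI
    have b0 := hI 0
    have b1 := hI 1
    rw [h0] at b0
    rw [h1] at b1
    simp only [Fin.exists_fin_succ, Fin.forall_fin_succ]
    simp
    omega

/-- Points `x_j ⊗ y_j ⊗ e_j` in a threefold tensor product have independent tangent spaces when
this can be checked slicewise in the first two factors. -/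
lemma tHolds_of_slices {s : ℕ} (n : Fin 3 → ℕ) (hs : s ≤ n 2 + 1) (x y : Fin s → ℕ → K)
    (mx my : Fin s → ℕ) (hmx : ∀ j, mx j ≤ n 0) (hmy : ∀ j, my j ≤ n 1)
    (hx : ∀ j, x j (mx j) ≠ 0) (hy : ∀ j, y j (my j) ≠ 0)
    (h : ∀ (j : Fin s) (r : Fin s → K) (X Y : ℕ → K), X (mx j) = 0 → Y (my j) = 0 →
      (∀ a ≤ n 0, ∀ b ≤ n 1, ∑ i, r i * (x i a * y i b) + (X a * y j b + x j a * Y b) = 0) →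
      r = 0 ∧ (∀ a ≤ n 0, X a = 0) ∧ ∀ b ≤ n 1, Y b = 0)
    (h' : ∀ r : Fin s → K, (∀ a ≤ n 0, ∀ b ≤ n 1, ∑ i, r i * (x i a * y i b) = 0) → r = 0) :
    THolds K n s (fun _ => 0) := by
  refine tHolds_of_independent (by omega) n
    (fun j => ![x j, y j, fun t => if t = j then 1 else 0]) (fun j => ![mx j, my j, j]) ?_ ?_ ?_
  · intro j i
    fin_cases i
    · exact hmx j
    · exact hmy j
    · exact Nat.le_of_lt_succ (j.2.trans_le hs)
  · intro j i
    fin_cases i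
    · exact hx j
    · exact hy j
    · simp
  intro r c hc hI
  have hc2 (j : Fin s) : c j 2 j = 0 := hc j 2
  have E (a b t : ℕ) (ha : a ≤ n 0) (hb : b ≤ n 1) (ht : t ≤ n 2) :
      ∑ j, (r j * (x j a * y j b * if t = j then 1 else 0) +
        ((c j 0 a * y j b * if t = j then 1 else 0) + (x j a * c j 1 b * if t = j then 1 else 0) +
          x j a * y j b * c j 2 t)) = 0 := by
    have := hI ![a, b, t] (by intro i; fin_cases i <;> assumption)
    simp only [Fin.sum_univ_three, Fin.prod_univ_three] at this
    exact this
  have key (j : Fin s) := h j (fun i => c i 2 j + if i = j then r j else 0) (c j 0) (c j 1)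
    (hc j 0) (hc j 1) (fun a ha b hb => by
      have e := E a b j ha hb (Nat.le_of_lt_succ (j.2.trans_le hs))
      have e₁ : ∑ i, (if i = j then r i * (x i a * y i b) + (c i 0 a * y i b + x i a * c i 1 b)
          else 0) = r j * (x j a * y j b) + (c j 0 a * y j b + x j a * c j 1 b) := by
        simp
      have e₂ : ∑ i, (if i = j then r i * (x i a * y i b) else 0) = r j * (x j a * y j b) := by
        simp
      have e₃ : ∑ i, (c i 2 j + if i = j then r j else 0) * (x i a * y i b) =
          ∑ i, c i 2 j * (x i a * y i b) + r j * (x j a * y j b) := by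
        rw [← e₂, ← Finset.sum_add_distrib]
        refine Finset.sum_congr rfl fun i _ => ?_
        split_ifs with hi
        · rw [hi]; ring
        · ring
      rw [e₃, add_assoc, ← e₁, ← Finset.sum_add_distrib]
      refine (Finset.sum_congr rfl fun i _ => ?_).trans e
      simp only [Fin.val_inj, @eq_comm _ j i]
      split_ifs <;> ring)
  have hr (j : Fin s) : r j = 0 := by
    have := congrFun (key j).1 j
    simpa [hc2] using this
  refine fun j => ⟨hr j, fun i t ht => ?_⟩
  fin_cases i
  · exact (key j).2.1 t ht
  · exact (key j).2.2 t ht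
  · by_cases hts : t < s
    · have := congrFun (key ⟨t, hts⟩).1 j
      simpa [hr] using this
    · refine congrFun (h' (fun i => c i 2 t) fun a ha b hb => ?_) j
      rw [← E a b t ha hb ht]
      refine Finset.sum_congr rfl fun i _ => ?_
      have : t ≠ i := fun h => hts (h ▸ i.2)
      simp only [if_neg this]
      ring

lemma tHolds_four_of_one_three_three [CharZero K] (n : Fin 3 → ℕ) (h0 : 1 ≤ n 0) (h1 : 3 ≤ n 1)
    (h2 : 3 ≤ n 2) : THolds K n 4 (fun _ => 0) := by
  refine tHolds_of_slices n (by omega)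
    (fun j t => if t = 0 then 1 else if t = 1 then ((j : ℕ) : K) else 0)
    (fun j t => if t = j then 1 else 0) (fun _ => 0) (fun j => j) (by simp) (by omega) (by simp)
    (by simp) ?_ ?_
  · intro j r X Y hX hY hE
    have hE₀ (i : Fin 4) := hE 0 (by omega) i (by omega)
    have hE₁ (i : Fin 4) := hE 1 (by omega) i (by omega)
    simp [Fin.val_inj] at hE₀ hE₁
    have hrj : r j = 0 := by
      simpa [hX, hY] using hE₀ j
    have hne (i : Fin 4) (hij : i ≠ j) : r i = 0 ∧ Y i = 0 := by
      have e₀ := hE₀ i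
      have e₁ := hE₁ i
      simp only [hij, hX, if_false, zero_add] at e₀ e₁
      have hij' : ((i : ℕ) : K) - ((j : ℕ) : K) ≠ 0 := by
        rwa [sub_ne_zero, ne_eq, Nat.cast_inj, Fin.val_inj]
      have hri : r i = 0 := by
        refine (mul_eq_zero.1 (?_ : (((i : ℕ) : K) - ((j : ℕ) : K)) * r i = 0)).resolve_left hij'
        linear_combination e₁ - (j : ℕ) * e₀
      exact ⟨hri, by simpa [hri] using e₀⟩
    have hr : r = 0 := by
      funext i
      rcases eq_or_ne i j with rfl | hij
      · exact hrj
      · exact (hne i hij).1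
    refine ⟨hr, fun a ha => ?_, fun b hb => ?_⟩
    · simpa [hr, hY] using hE a ha j (by omega)
    · rcases eq_or_ne b j with rfl | hbj
      · exact hY
      · simpa [hr, hbj] using hE 0 (by omega) b hb
  · intro r hE
    funext i
    simpa [Fin.val_inj] using hE 0 (by omega) i (by omega)

lemma tHolds_four_of_two_two_three (n : Fin 3 → ℕ) (h0 : n 0 = 2) (h1 : n 1 = 2)
    (h2 : 3 ≤ n 2) : THolds K n 4 (fun _ => 0) := by
  refine tHolds_of_slices n (by omega)
    (fun j t => if t = j ∨ j = 3 then 1 else 0) (fun j t => if t = j ∨ j = 3 then 1 else 0)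
    ![0, 1, 2, 0] ![0, 1, 2, 0] ?_ ?_ ?_ ?_ ?_ ?_
  · intro j
    fin_cases j <;> simp [h0]
  · intro j
    fin_cases j <;> simp [h1]
  · intro j
    fin_cases j <;> simp
  · intro j
    fin_cases j <;> simp
  · rw [h0, h1]
    intro j r X Y hX hY hE
    have e (a b : Fin 3) := hE a (by omega) b (by omega)
    have e₀₀ := e 0 0
    have e₀₁ := e 0 1
    have e₀₂ := e 0 2
    have e₁₀ := e 1 0
    have e₁₁ := e 1 1
    have e₁₂ := e 1 2
    have e₂₀ := e 2 0
    have e₂₁ := e 2 1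
    have e₂₂ := e 2 2
    clear e hE
    simp only [Fin.sum_univ_four] at e₀₀ e₀₁ e₀₂ e₁₀ e₁₁ e₁₂ e₂₀ e₂₁ e₂₂
    suffices (r 0 = 0 ∧ r 1 = 0 ∧ r 2 = 0 ∧ r 3 = 0) ∧ (X 0 = 0 ∧ X 1 = 0 ∧ X 2 = 0) ∧
        Y 0 = 0 ∧ Y 1 = 0 ∧ Y 2 = 0 by
      obtain ⟨hr, hX', hY'⟩ := this
      refine ⟨funext fun i => ?_, fun a ha => ?_, fun b hb => ?_⟩
      · fin_cases i <;> simp [hr]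
      · interval_cases a <;> simp [hX']
      · interval_cases b <;> simp [hY']
    fin_cases j <;> simp at hX hY e₀₀ e₀₁ e₀₂ e₁₀ e₁₁ e₁₂ e₂₀ e₂₁ e₂₂ <;> grind
  · rw [h0, h1]
    intro r hE
    have e₀₀ := hE 0 (by omega) 0 (by omega)
    have e₀₁ := hE 0 (by omega) 1 (by omega)
    have e₁₁ := hE 1 (by omega) 1 (by omega)
    have e₂₂ := hE 2 (by omega) 2 (by omega)
    simp [Fin.sum_univ_four] at e₀₀ e₀₁ e₁₁ e₂₂
    funext i
    fin_cases i <;> simp_all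

lemma tHolds_four_one_one_one_two (n : Fin 4 → ℕ) (h0 : n 0 = 1) (h1 : n 1 = 1)
    (h2 : n 2 = 1) (h3 : n 3 = 2) : THolds K n 4 (fun _ => 0) := by
  refine tHolds_of_independent (by omega) n
    ![![fun t => if t = 0 then 1 else 0, fun t => if t = 0 then 1 else 0,
        fun t => if t = 0 then 1 else 0, fun t => if t = 0 then 1 else 0],
      ![fun t => if t = 1 then 1 else 0, fun t => if t = 0 then 1 else 0,
        fun t => if t = 1 then 1 else 0, fun t => if t = 1 then 1 else 0],
      ![fun _ => 1, fun t => if t = 1 then 1 else 0,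
        fun t => if t = 0 then 1 else 0, fun _ => 1],
      ![fun t => if t = 0 then 1 else 0, fun t => if t = 1 then 1 else 0,
        fun t => if t = 1 then 1 else 0, fun t => if t = 2 then 1 else 0]]
    ![![0, 0, 0, 0], ![1, 0, 1, 1], ![0, 1, 0, 0], ![0, 1, 1, 2]] ?_ ?_ ?_
  · intro j i
    fin_cases i <;> fin_cases j <;> simp [*]
  · intro j i
    fin_cases i <;> fin_cases j <;> simp
  intro r c hc hI
  have E (a b d t : ℕ) (ha : a ≤ 1) (hb : b ≤ 1) (hd : d ≤ 1) (ht : t ≤ 2) := hI ![a, b, d, t] (by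
    intro i
    fin_cases i
    · exact ha.trans h0.ge
    · exact hb.trans h1.ge
    · exact hd.trans h2.ge
    · exact ht.trans h3.ge)
  simp only [Fin.prod_univ_four, Fin.sum_univ_four] at E
  simp at E
  have e₀₀₀₀ := E 0 0 0 0 (by simp) (by simp) (by simp) (by simp)
  have e₀₀₀₁ := E 0 0 0 1 (by simp) (by simp) (by simp) (by simp)
  have e₀₀₀₂ := E 0 0 0 2 (by simp) (by simp) (by simp) (by simp)
  have e₀₀₁₀ := E 0 0 1 0 (by simp) (by simp) (by simp) (by simp)
  have e₀₀₁₁ := E 0 0 1 1 (by simp) (by simp) (by simp) (by simp)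
  have e₀₀₁₂ := E 0 0 1 2 (by simp) (by simp) (by simp) (by simp)
  have e₀₁₀₀ := E 0 1 0 0 (by simp) (by simp) (by simp) (by simp)
  have e₀₁₀₁ := E 0 1 0 1 (by simp) (by simp) (by simp) (by simp)
  have e₀₁₀₂ := E 0 1 0 2 (by simp) (by simp) (by simp) (by simp)
  have e₀₁₁₀ := E 0 1 1 0 (by simp) (by simp) (by simp) (by simp)
  have e₀₁₁₁ := E 0 1 1 1 (by simp) (by simp) (by simp) (by simp)
  have e₀₁₁₂ := E 0 1 1 2 (by simp) (by simp) (by simp) (by simp)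
  have e₁₀₀₀ := E 1 0 0 0 (by simp) (by simp) (by simp) (by simp)
  have e₁₀₀₁ := E 1 0 0 1 (by simp) (by simp) (by simp) (by simp)
  have e₁₀₀₂ := E 1 0 0 2 (by simp) (by simp) (by simp) (by simp)
  have e₁₀₁₀ := E 1 0 1 0 (by simp) (by simp) (by simp) (by simp)
  have e₁₀₁₁ := E 1 0 1 1 (by simp) (by simp) (by simp) (by simp)
  have e₁₀₁₂ := E 1 0 1 2 (by simp) (by simp) (by simp) (by simp)
  have e₁₁₀₀ := E 1 1 0 0 (by simp) (by simp) (by simp) (by simp)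
  have e₁₁₀₁ := E 1 1 0 1 (by simp) (by simp) (by simp) (by simp)
  have e₁₁₀₂ := E 1 1 0 2 (by simp) (by simp) (by simp) (by simp)
  have e₁₁₁₀ := E 1 1 1 0 (by simp) (by simp) (by simp) (by simp)
  have e₁₁₁₁ := E 1 1 1 1 (by simp) (by simp) (by simp) (by simp)
  have e₁₁₁₂ := E 1 1 1 2 (by simp) (by simp) (by simp) (by simp)
  have hc₀ := hc 0
  have hc₁ := hc 1
  have hc₂ := hc 2
  have hc₃ := hc 3
  clear hI hc E
  simp [Fin.forall_fin_succ] at hc₀ hc₁ hc₂ hc₃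
  simp at e₀₀₀₀ e₀₀₀₁ e₀₀₀₂ e₀₀₁₀ e₀₀₁₁ e₀₀₁₂ e₀₁₀₀ e₀₁₀₁
  simp at e₀₁₀₂ e₀₁₁₀ e₀₁₁₁ e₀₁₁₂ e₁₀₀₀ e₁₀₀₁ e₁₀₀₂ e₁₀₁₀
  simp at e₁₀₁₁ e₁₀₁₂ e₁₁₀₀ e₁₁₀₁ e₁₁₀₂ e₁₁₁₀ e₁₁₁₁ e₁₁₁₂
  obtain ⟨_, _, _, _⟩ := hc₀
  obtain ⟨_, _, _, _⟩ := hc₁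
  obtain ⟨_, _, _, _⟩ := hc₂
  obtain ⟨_, _, _, _⟩ := hc₃
  intro j
  refine ⟨by fin_cases j <;> grind, fun i t ht => ?_⟩
  have ht2 : t ≤ ![1, 1, 1, 2] i := by
    refine ht.trans ?_
    fin_cases i <;> simp [*]
  clear ht h0 h1 h2 h3
  fin_cases i <;> simp at ht2 <;> interval_cases t <;> fin_cases j <;> grind

/-- The pure tensor `e_a ⊗ e_b ⊗ e_c` in a threefold tensor product, as a family of vectors. -/
noncomputable def coordTriple (K : Type*) [Field K] (n : Fin 3 → ℕ) (a b c : ℕ) :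
    ∀ i, Fin (n i + 1) → K :=
  fun i t => if (t : ℕ) = ![a, b, c] i then 1 else 0

lemma update_coordTriple_zero (n : Fin 3 → ℕ) (a b c a' : ℕ) :
    Function.update (coordTriple K n a b c) 0 (coordTriple K n a' b c 0) =
      coordTriple K n a' b c := by
  funext i
  fin_cases i <;> rfl

lemma update_coordTriple_one (n : Fin 3 → ℕ) (a b c b' : ℕ) :
    Function.update (coordTriple K n a b c) 1 (coordTriple K n a b' c 1) =
      coordTriple K n a b' c := by
  funext i
  fin_cases i <;> rfl

lemma update_coordTriple_two (n : Fin 3 → ℕ) (a b c c' : ℕ) :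
    Function.update (coordTriple K n a b c) 2 (coordTriple K n a b c' 2) =
      coordTriple K n a b c' := by
  funext i
  fin_cases i <;> rfl

lemma segreBasis_eq_coordTriple (n : Fin 3 → ℕ) (I : ∀ i, Fin (n i + 1)) :
    segreBasis K n I = PiTensorProduct.tprod K (coordTriple K n (I 0) (I 1) (I 2)) := by
  rw [segreBasis_apply]
  congr 1
  funext i t
  fin_cases i <;> simp [coordTriple, Pi.single_apply, Fin.ext_iff] <;> rfl

lemma coordTriple_ne_zero {n : Fin 3 → ℕ} {a b c : ℕ} (ha : a ≤ n 0) (hb : b ≤ n 1)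
    (hc : c ≤ n 2) (i : Fin 3) : coordTriple K n a b c i ≠ 0 := by
  have hle : ![a, b, c] i ≤ n i := by fin_cases i <;> assumption
  intro h
  simpa [coordTriple] using congrFun h ⟨_, Nat.lt_succ_of_le hle⟩

lemma tHolds_four_one_two_three (n : Fin 3 → ℕ) (h0 : n 0 = 1) (h1 : n 1 = 2)
    (h2 : n 2 = 3) : THolds K n 4 (fun _ => 0) := by
  have cover (P : ℕ → ℕ → ℕ → Prop) (x₀ : ∀ a, P a 0 0) (y₀ : ∀ b, P 0 b 0) (z₀ : ∀ c, P 0 0 c)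
      (x₁ : ∀ a, P a 1 1) (y₁ : ∀ b, P 1 b 1) (z₁ : ∀ c, P 1 1 c) (x₂ : ∀ a, P a 2 2)
      (y₂ : ∀ b, P 0 b 2 ↔ P 1 b 2) (z₂ : ∀ c, P 0 2 c ↔ P 1 2 c)
      (x₃ : ∀ a, P a 0 3) (y₃ : ∀ b, P 0 b 3) (a b c : ℕ) (ha : a < 2) (hb : b < 3)
      (hc : c < 4) : P a b c := by
    interval_cases a <;> interval_cases b <;> interval_cases c <;> grind
  obtain ⟨u, hu⟩ : ∃ u, u = coordTriple K n 0 2 2 0 + coordTriple K n 1 2 2 0 := ⟨_, rfl⟩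
  obtain ⟨p, hp₀, hp₁, hp₂, hp₃⟩ : ∃ p : Fin 4 → ∀ i, Fin (n i + 1) → K,
      p 0 = coordTriple K n 0 0 0 ∧ p 1 = coordTriple K n 1 1 1 ∧
      p 2 = Function.update (coordTriple K n 0 2 2) 0 u ∧ p 3 = coordTriple K n 0 0 3 :=
    ⟨![_, _, _, _], rfl, rfl, rfl, rfl⟩
  have hu0 : u ≠ 0 := by
    intro h
    simpa [hu, coordTriple] using congrFun h 0
  refine tHolds_of_iSup_eq_top p ?_ (by simp [Fin.prod_univ_three, Fin.sum_univ_three, *]) ?_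
  · have hne {a b c : ℕ} (ha : a ≤ n 0) (hb : b ≤ n 1) (hc : c ≤ n 2) :=
      coordTriple_ne_zero (K := K) ha hb hc
    intro j i
    fin_cases j
    · exact hp₀ ▸ hne (by omega) (by omega) (by omega) i
    · exact hp₁ ▸ hne (by omega) (by omega) (by omega) i
    · change p 2 i ≠ 0
      rw [hp₂]
      rcases eq_or_ne i 0 with rfl | hi
      · simpa using hu0
      · rw [Function.update_of_ne hi]
        exact hne (by omega) (by omega) (by omega) i
    · exact hp₃ ▸ hne (by omega) (by omega) (by omega) i
  have hS := tprod_update_mem_iSup n p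
  generalize ⨆ j, segreTangent K n (p j) = S at hS ⊢
  have hadd (b c : ℕ) : PiTensorProduct.tprod K (Function.update (coordTriple K n 0 b c) 0 u) =
      PiTensorProduct.tprod K (coordTriple K n 0 b c) +
        PiTensorProduct.tprod K (coordTriple K n 1 b c) := by
    rw [hu, MultilinearMap.map_update_add]
    congr 2
    · exact update_coordTriple_zero n 0 b c 0
    · exact update_coordTriple_zero n 0 b c 1
  have hx {j a b c} (hj : p j = coordTriple K n a b c) (a' : ℕ) :
      PiTensorProduct.tprod K (coordTriple K n a' b c) ∈ S := by
    rw [← update_coordTriple_zero n a, ← hj]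
    exact hS j 0 _
  have hy {j a b c} (hj : p j = coordTriple K n a b c) (b' : ℕ) :
      PiTensorProduct.tprod K (coordTriple K n a b' c) ∈ S := by
    rw [← update_coordTriple_one n a b, ← hj]
    exact hS j 1 _
  have hz {j a b c} (hj : p j = coordTriple K n a b c) (c' : ℕ) :
      PiTensorProduct.tprod K (coordTriple K n a b c') ∈ S := by
    rw [← update_coordTriple_two n a b c, ← hj]
    exact hS j 2 _
  have x₂ (a : ℕ) : PiTensorProduct.tprod K (coordTriple K n a 2 2) ∈ S := by
    have := hS 2 0 (coordTriple K n a 2 2 0)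
    rwa [hp₂, Function.update_idem, update_coordTriple_zero] at this
  have hiff {b c : ℕ} (h : PiTensorProduct.tprod K
      (Function.update (coordTriple K n 0 b c) 0 u) ∈ S) :
      PiTensorProduct.tprod K (coordTriple K n 0 b c) ∈ S ↔
        PiTensorProduct.tprod K (coordTriple K n 1 b c) ∈ S := by
    rw [hadd] at h
    exact ⟨fun h' => (Submodule.add_mem_iff_right S h').1 h,
      fun h' => (Submodule.add_mem_iff_left S h').1 h⟩
  rw [eq_top_iff, ← (segreBasis K n).span_eq, Submodule.span_le]
  rintro _ ⟨I, rfl⟩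
  rw [SetLike.mem_coe, segreBasis_eq_coordTriple]
  refine cover (fun a b c => PiTensorProduct.tprod K (coordTriple K n a b c) ∈ S)
    (hx hp₀) (hy hp₀) (hz hp₀) (hx hp₁) (hy hp₁) (hz hp₁) x₂ (fun b => hiff ?_) (fun c => hiff ?_)
    (hx hp₃) (hy hp₃) _ _ _ (by have := (I 0).2; omega) (by have := (I 1).2; omega)
    (by have := (I 2).2; omega)
  · have := hS 2 1 (coordTriple K n 0 b 2 1)
    rwa [hp₂, Function.update_comm (by decide), update_coordTriple_one] at this
  · have := hS 2 2 (coordTriple K n 0 2 c 2)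
    rwa [hp₂, Function.update_comm (by decide), update_coordTriple_two] at this

lemma finrank_iSup_le_sum {V ι : Type*} [AddCommGroup V] [Module K V] [FiniteDimensional K V]
    [Fintype ι] (f : ι → Submodule K V) :
    Module.finrank K ↥(⨆ i, f i) ≤ ∑ i, Module.finrank K ↥(f i) := by
  classical
  rw [← Finset.sup_univ_eq_iSup]
  induction (Finset.univ : Finset ι) using Finset.induction_on with
  | empty => simp
  | insert i s hi ih =>
    rw [Finset.sup_insert, Finset.sum_insert hi]
    exact (Submodule.finrank_add_le_finrank_add_finrank _ _).trans (Nat.add_le_add_left ih _)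

lemma tprod_mem_of_single (n : Fin k → ℕ) (A : Submodule K (⨂[K] i, (Fin (n i + 1) → K)))
    (v : ∀ i, Fin (n i + 1) → K) (i : Fin k)
    (h : ∀ t, PiTensorProduct.tprod K (Function.update v i (Pi.single t 1)) ∈ A) :
    PiTensorProduct.tprod K v ∈ A := by
  have htop : (⊤ : Submodule K (Fin (n i + 1) → K)) ≤
      A.comap ((PiTensorProduct.tprod K).toLinearMap v i) := by
    rw [← (Pi.basisFun K (Fin (n i + 1))).span_eq, Submodule.span_le]
    rintro _ ⟨t, rfl⟩
    simpa using h t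
  simpa using htop (Submodule.mem_top (x := v i))

lemma tFails_four_one_two_of_four_le (n : Fin 3 → ℕ) (h0 : n 0 = 1) (h1 : n 1 = 2)
    (h2 : 4 ≤ n 2) : TFails K n 4 (fun _ => 0) := by
  refine tFails_of_finrank_lt fun p _ => ?_
  set W : Submodule K (Fin (n 2 + 1) → K) := Submodule.span K (Set.range fun j => p j 2) with hW
  obtain ⟨C, hC⟩ := Submodule.exists_isCompl W
  set L : Fin (n 0 + 1) × Fin (n 1 + 1) → (Fin (n 2 + 1) → K) →ₗ[K]
      ⨂[K] i, (Fin (n i + 1) → K) := fun ab => (PiTensorProduct.tprod K).toLinearMap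
    (Function.update (Function.update (0 : ∀ i, Fin (n i + 1) → K) 0 (Pi.single ab.1 1)) 1
      (Pi.single ab.2 1)) 2 with hL
  set A : Submodule K (⨂[K] i, (Fin (n i + 1) → K)) :=
    (⨆ ab, W.map (L ab)) ⊔
      ⨆ j, C.map ((PiTensorProduct.tprod K).toLinearMap (p j) 2) with hA
  have hmem (v : ∀ i, Fin (n i + 1) → K) (hv : v 2 ∈ W) : PiTensorProduct.tprod K v ∈ A := by
    refine tprod_mem_of_single n A v 0 fun a => tprod_mem_of_single n A _ 1 fun b => ?_
    refine Submodule.mem_sup_left (Submodule.mem_iSup_of_mem (a, b) ⟨v 2, hv, ?_⟩)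
    refine congrArg (PiTensorProduct.tprod K) (funext fun i => ?_)
    fin_cases i <;> rfl
  have hpW (j : Fin 4) : p j 2 ∈ W := Submodule.subset_span ⟨j, rfl⟩
  have hle : ⨆ j, segreTangent K n (p j) ≤ A := by
    rw [iSup_segreTangent_le_iff]
    intro j i x
    rcases eq_or_ne i 2 with rfl | hi
    · obtain ⟨w, hw, c, hc, rfl⟩ := Submodule.mem_sup.1
        (hC.sup_eq_top ▸ Submodule.mem_top : x ∈ W ⊔ C)
      rw [MultilinearMap.map_update_add]
      refine A.add_mem (hmem _ (by simpa using hw)) ?_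
      exact Submodule.mem_sup_right (Submodule.mem_iSup_of_mem j ⟨c, hc, rfl⟩)
    · exact hmem _ (by rw [Function.update_of_ne hi.symm]; exact hpW j)
  have hr : Module.finrank K W ≤ 4 :=
    (finrank_range_le_card (R := K) fun j => p j 2).trans (by simp)
  have hrC : Module.finrank K W + Module.finrank K C = n 2 + 1 := by
    simpa using Submodule.finrank_add_eq_of_isCompl hC
  have hfin : Module.finrank K A ≤ 6 * Module.finrank K W + 4 * Module.finrank K C := by
    refine (Submodule.finrank_add_le_finrank_add_finrank _ _).trans (add_le_add ?_ ?_)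
    · refine (finrank_iSup_le_sum _).trans ((Finset.sum_le_card_nsmul _ _ _
        fun ab _ => Submodule.finrank_map_le (L ab) W).trans ?_)
      simp [h0, h1]
    · refine (finrank_iSup_le_sum _).trans ((Finset.sum_le_card_nsmul _ _ _
        fun j _ => Submodule.finrank_map_le _ C).trans ?_)
      simp
  have := Submodule.finrank_mono hle
  rw [Fin.sum_univ_three, Fin.prod_univ_three, h0, h1]
  omega

open Matrix in
lemma exists_matrix_vanishing (b c : Fin 4 → Fin 3 → K) (j₀ : Fin 4) (hc : c j₀ ≠ 0) :
    ∃ Ψ : Matrix (Fin 3) (Fin 3) K, Ψ ≠ 0 ∧ (∀ j, b j ⬝ᵥ Ψ *ᵥ c j = 0) ∧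
      Ψ *ᵥ c j₀ = 0 ∧ b j₀ ᵥ* Ψ = 0 := by
  obtain ⟨m, hm⟩ := Function.ne_iff.1 hc
  let F : Matrix (Fin 3) (Fin 3) K →ₗ[K]
      ({j : Fin 4 // j ≠ j₀} → K) × (Fin 3 → K) × ({t : Fin 3 // t ≠ m} → K) :=
    { toFun := fun Ψ => (fun j => b j ⬝ᵥ Ψ *ᵥ c j, Ψ *ᵥ c j₀, fun t => (b j₀ ᵥ* Ψ) t)
      map_add' := fun A B => by
        refine Prod.ext (funext fun j => ?_) (Prod.ext ?_ (funext fun t => ?_)) <;>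
          simp [Matrix.add_mulVec, Matrix.vecMul_add]
      map_smul' := fun r A => by
        refine Prod.ext (funext fun j => ?_) (Prod.ext ?_ (funext fun t => ?_)) <;>
          simp [Matrix.smul_mulVec, Matrix.vecMul_smul] }
  have hker := LinearMap.ker_ne_bot_of_finrank_lt (f := F) (by
    simp [Module.finrank_prod, Module.finrank_matrix, Fintype.card_subtype_compl])
  obtain ⟨Ψ, hΨ, hΨ0⟩ := Submodule.exists_mem_ne_zero_of_ne_bot hker
  obtain ⟨h₁, h₂, h₃⟩ : _ ∧ _ ∧ _ := by simpa [F] using hΨ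
  refine ⟨Ψ, hΨ0, fun j => ?_, h₂, ?_⟩
  · rcases eq_or_ne j j₀ with rfl | hj
    · rw [h₂, dotProduct_zero]
    · exact congrFun h₁ ⟨j, hj⟩
  · have h₃' (t : Fin 3) (ht : t ≠ m) : (b j₀ ᵥ* Ψ) t = 0 := congrFun h₃ ⟨t, ht⟩
    have : b j₀ ᵥ* Ψ ⬝ᵥ c j₀ = 0 := by rw [← dotProduct_mulVec, h₂, dotProduct_zero]
    rw [dotProduct, Finset.sum_eq_single m (fun t _ ht => by rw [h₃' t ht, zero_mul])
      (by simp)] at this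
    funext t
    rcases eq_or_ne t m with rfl | ht
    · exact (mul_eq_zero.1 this).resolve_right hm
    · exact h₃' t ht

open Matrix in
/-- The trilinear form `(x, y, z) ↦ (l ⬝ x) (y ⬝ Ψ z)`. -/
def dotMulBilin (l : Fin 3 → K) (Ψ : Matrix (Fin 3) (Fin 3) K) :
    MultilinearMap K (fun _ : Fin 3 => Fin 3 → K) K where
  toFun v := (l ⬝ᵥ v 0) * (v 1 ⬝ᵥ Ψ *ᵥ v 2)
  map_update_add' := @fun inst v i x y => by
    obtain rfl := Subsingleton.elim inst (instDecidableEqFin 3)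
    fin_cases i <;> simp [mulVec_add] <;> ring
  map_update_smul' := @fun inst v i r x => by
    obtain rfl := Subsingleton.elim inst (instDecidableEqFin 3)
    fin_cases i <;> simp [mulVec_smul] <;> ring

/-- Four points with the first three components `p j 0`, `j ≠ j₀`, on a line. -/
lemma exists_vanishing_of_collinear (p : Fin 4 → Fin 3 → Fin 3 → K) (hp : ∀ j i, p j i ≠ 0)
    (j₀ : Fin 4) (l : Fin 3 → K) (hl : l ≠ 0) (h : ∀ j, j ≠ j₀ → l ⬝ᵥ p j 0 = 0) :
    ∃ G : MultilinearMap K (fun _ : Fin 3 => Fin 3 → K) K, G ≠ 0 ∧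
      ∀ j i x, G (Function.update (p j) i x) = 0 := by
  obtain ⟨Ψ, hΨ0, h₁, h₂, h₃⟩ :=
    exists_matrix_vanishing (fun j => p j 1) (fun j => p j 2) j₀ (hp j₀ 2)
  refine ⟨dotMulBilin l Ψ, fun h0 => ?_, fun j i x => ?_⟩
  · obtain ⟨m, hm⟩ := Function.ne_iff.1 hl
    refine hΨ0 (Matrix.ext fun s t => ?_)
    have := congrArg (fun G => G ![Pi.single m 1, Pi.single s 1, Pi.single t 1]) h0
    simp [dotMulBilin] at this
    exact this.resolve_left hm
  · rcases eq_or_ne j j₀ with rfl | hj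
    · have h₃' (z : Fin 3 → K) : p j 1 ⬝ᵥ Ψ.mulVec z = 0 := by
        rw [Matrix.dotProduct_mulVec, h₃, zero_dotProduct]
      fin_cases i <;> simp [dotMulBilin, h₂, h₃']
    · fin_cases i <;> simp [dotMulBilin, h j hj, h₁]

lemma exists_vanishing_comp_perm (p : Fin 4 → Fin 3 → Fin 3 → K) (σ : Equiv.Perm (Fin 3))
    (h : ∃ G : MultilinearMap K (fun _ : Fin 3 => Fin 3 → K) K, G ≠ 0 ∧
      ∀ j i x, G (Function.update (p j ∘ σ) i x) = 0) :
    ∃ G : MultilinearMap K (fun _ : Fin 3 => Fin 3 → K) K, G ≠ 0 ∧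
      ∀ j i x, G (Function.update (p j) i x) = 0 := by
  obtain ⟨G, hG, h⟩ := h
  refine ⟨G.domDomCongr σ, fun h0 => hG ?_, fun j i x => ?_⟩
  · refine MultilinearMap.ext fun v => ?_
    have := congrArg (fun G => G fun i => v (σ.symm i)) h0
    simpa using this
  · have := h j (σ.symm i) x
    rwa [← Function.update_comp_equiv] at this

lemma det_eq_zero_of_smul {M : Fin 3 → Fin 3 → K} {l l' : Fin 3} (hl : l ≠ l') {r r' : K}
    {w : Fin 3 → K} (h : M l = r • w) (h' : M l' = r' • w) :
    (Matrix.detRowAlternating : (Fin 3 → K) [⋀^Fin 3]→ₗ[K] K) M = 0 := by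
  have hM : M = Function.update (Function.update M l (r • w)) l' (r' • w) := by
    rw [← h, Function.update_eq_self, ← h', Function.update_eq_self]
  rw [hM, AlternatingMap.map_update_smul, Function.update_comm hl,
    AlternatingMap.map_update_smul, AlternatingMap.map_eq_zero_of_eq _ _ ?_ hl]
  · simp
  · simp [hl.symm]

lemma exists_normalizing_matrix (a : Fin 4 → Fin 3 → K)
    (h : ∀ j₀ l, (∀ j, j ≠ j₀ → l ⬝ᵥ a j = 0) → l = 0) :
    ∃ P : Matrix (Fin 3) (Fin 3) K, ∃ r : Fin 3 → K, (∀ i, r i ≠ 0) ∧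
      (∀ i, P.mulVec (a i.castSucc) = r i • Pi.single i 1) ∧ P.mulVec (a 3) = 1 := by
  let F : (Fin 3 → K) →ₗ[K] (Fin 3 → K) := (Matrix.of fun i : Fin 3 => a i.castSucc).mulVecLin
  have hF (l : Fin 3 → K) (i : Fin 3) : F l i = l ⬝ᵥ a i.castSucc :=
    dotProduct_comm (a i.castSucc) l
  have hinj : Function.Injective F := by
    rw [← LinearMap.ker_eq_bot, LinearMap.ker_eq_bot']
    intro l hl
    refine h 3 l fun j hj => ?_
    obtain ⟨i, rfl⟩ := Fin.exists_castSucc_eq.2 hj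
    rw [← hF, hl, Pi.zero_apply]
  choose L hL using fun i : Fin 3 => LinearMap.surjective_of_injective hinj (Pi.single i 1)
  have hLa (i t : Fin 3) : L i ⬝ᵥ a t.castSucc = (Pi.single i 1 : Fin 3 → K) t := by
    rw [← hF, hL]
  have hL3 (i : Fin 3) : L i ⬝ᵥ a 3 ≠ 0 := by
    intro h3
    have := h i.castSucc (L i) fun j hj => by
      rcases eq_or_ne j 3 with rfl | hj3
      · exact h3
      · obtain ⟨t, rfl⟩ := Fin.exists_castSucc_eq.2 hj3
        rw [hLa, Pi.single_eq_of_ne fun e => hj (by rw [e])]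
    have h1 := hLa i i
    simp [this] at h1
  refine ⟨Matrix.of fun i => (L i ⬝ᵥ a 3)⁻¹ • L i, fun i => (L i ⬝ᵥ a 3)⁻¹,
    fun i => inv_ne_zero (hL3 i), fun i => funext fun t => ?_, funext fun t => ?_⟩
  · have : ((L t ⬝ᵥ a 3)⁻¹ • L t) ⬝ᵥ a i.castSucc =
        (L i ⬝ᵥ a 3)⁻¹ * (Pi.single i 1 : Fin 3 → K) t := by
      rw [smul_dotProduct, hLa, smul_eq_mul]
      rcases eq_or_ne i t with rfl | hit
      · rfl
      · simp [hit, hit.symm]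
    exact this
  · have : ((L t ⬝ᵥ a 3)⁻¹ • L t) ⬝ᵥ a 3 = 1 := by
      rw [smul_dotProduct, smul_eq_mul, inv_mul_cancel₀ (hL3 t)]
    exact this

lemma exists_vanishing_trilinear (p : Fin 4 → Fin 3 → Fin 3 → K) (hp : ∀ j i, p j i ≠ 0) :
    ∃ G : MultilinearMap K (fun _ : Fin 3 => Fin 3 → K) K, G ≠ 0 ∧
      ∀ j i x, G (Function.update (p j) i x) = 0 := by
  by_cases H : ∀ i j₀ l, (∀ j, j ≠ j₀ → l ⬝ᵥ p j i = 0) → l = 0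
  · choose P r hr hP hP3 using fun i => exists_normalizing_matrix (fun j => p j i) (H i)
    refine ⟨(Matrix.detRowAlternating : (Fin 3 → K) [⋀^Fin 3]→ₗ[K] K).toMultilinearMap.compLinearMap
      fun i => (P i).mulVecLin, fun h0 => ?_, fun j i x => ?_⟩
    · have := congrArg (fun G => G fun i => p i.castSucc i) h0
      simp only [MultilinearMap.compLinearMap_apply, Matrix.mulVecLin_apply, hP] at this
      have hdiag : (fun i => r i i • Pi.single i 1) = Matrix.diagonal fun i => r i i := by
        ext s t
        simp [Matrix.diagonal_apply, Pi.single_apply, eq_comm]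
      rw [hdiag] at this
      exact Finset.prod_ne_zero_iff.2 (fun i _ => hr i i) (Matrix.det_diagonal.symm.trans this)
    · obtain ⟨l, l', hll, hl, hl'⟩ : ∃ l l' : Fin 3, l ≠ l' ∧ l ≠ i ∧ l' ≠ i := by
        revert i
        decide
      obtain ⟨w, hw⟩ : ∃ w : Fin 3 → K, ∀ l, ∃ c : K, (P l).mulVec (p j l) = c • w := by
        rcases eq_or_ne j 3 with rfl | hj
        · exact ⟨1, fun l => ⟨1, by rw [hP3, one_smul]⟩⟩
        · obtain ⟨t, rfl⟩ := Fin.exists_castSucc_eq.2 hj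
          exact ⟨Pi.single t 1, fun l => ⟨r l t, hP l t⟩⟩
      obtain ⟨c, hc⟩ := hw l
      obtain ⟨c', hc'⟩ := hw l'
      refine det_eq_zero_of_smul hll (w := w) (r := c) (r' := c') ?_ ?_
      · simp [hl, hc]
      · simp [hl', hc']
  · push Not at H
    obtain ⟨i, j₀, l, hl, hl0⟩ := H
    refine exists_vanishing_comp_perm p (Equiv.swap 0 i)
      (exists_vanishing_of_collinear _ (fun j t => hp j _) j₀ l hl0 fun j hj => ?_)
    simpa using hl j hj

lemma tFails_four_two_two_two (n : Fin 3 → ℕ) (h0 : n 0 = 2) (h1 : n 1 = 2) (h2 : n 2 = 2) :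
    TFails K n 4 (fun _ => 0) := by
  obtain rfl : n = fun _ => 2 := by
    funext i
    fin_cases i <;> assumption
  refine tFails_of_finrank_lt fun p hp => ?_
  obtain ⟨G, hG, h⟩ := exists_vanishing_trilinear p hp
  have hle : ⨆ j, segreTangent K (fun _ => 2) (p j) ≤
      LinearMap.ker (PiTensorProduct.lift G) := by
    rw [iSup_segreTangent_le_iff]
    intro j i x
    rw [LinearMap.mem_ker, PiTensorProduct.lift.tprod]
    exact h j i x
  have hker : LinearMap.ker (PiTensorProduct.lift G) < ⊤ := by
    rw [lt_top_iff_ne_top, ne_eq, LinearMap.ker_eq_top]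
    exact fun h0 => hG ((LinearEquiv.map_eq_zero_iff _).1 h0)
  have := Submodule.finrank_lt (hle.trans_lt hker).ne
  rw [finrank_tensor] at this
  refine this.trans_le ?_
  simp
end Segre

/-- classification of defective 4-secant varieties.  Let `k ≥ 3` and
`1 ≤ n₁ ≤ ⋯ ≤ n_k`.  Then `T(n; 4; 0,…,0)` holds unless `(n₁,…,n_k) = (1,2,a)` with
`a ≥ 4` or `(n₁,…,n_k) = (2,2,2)`, and in these exceptional cases it fails. -/
theorem secant4_classification
    (K : Type*) [Field K] [CharZero K] {k : ℕ} (hk : 3 ≤ k)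
    (n : Fin k → ℕ) (hmono : Monotone n) (hpos : ∀ i, 1 ≤ n i) :
    (¬ ((k = 3 ∧ n ⟨0, by omega⟩ = 1 ∧ n ⟨1, by omega⟩ = 2 ∧ 4 ≤ n ⟨2, by omega⟩) ∨
        (k = 3 ∧ n ⟨0, by omega⟩ = 2 ∧ n ⟨1, by omega⟩ = 2 ∧ n ⟨2, by omega⟩ = 2)) →
      THolds K n 4 (fun _ => 0)) ∧
    (((k = 3 ∧ n ⟨0, by omega⟩ = 1 ∧ n ⟨1, by omega⟩ = 2 ∧ 4 ≤ n ⟨2, by omega⟩) ∨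
        (k = 3 ∧ n ⟨0, by omega⟩ = 2 ∧ n ⟨1, by omega⟩ = 2 ∧ n ⟨2, by omega⟩ = 2)) →
      TFails K n 4 (fun _ => 0)) := by
  have mono {i j : ℕ} (hij : i ≤ j) (hj : j < k) : n ⟨i, hij.trans_lt hj⟩ ≤ n ⟨j, hj⟩ :=
    hmono (Fin.mk_le_mk.2 hij)
  obtain rfl | rfl | hk5 : k = 3 ∨ k = 4 ∨ 5 ≤ k := by omega
  · have h01 : n 0 ≤ n 1 := mono (by omega : 0 ≤ 1) (by omega)
    have h12 : n 1 ≤ n 2 := mono (by omega : 1 ≤ 2) (by omega)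
    have hp : 1 ≤ n 0 := hpos 0
    change (¬ ((3 = 3 ∧ n 0 = 1 ∧ n 1 = 2 ∧ 4 ≤ n 2) ∨ (3 = 3 ∧ n 0 = 2 ∧ n 1 = 2 ∧ n 2 = 2)) →
      _) ∧ (((3 = 3 ∧ n 0 = 1 ∧ n 1 = 2 ∧ 4 ≤ n 2) ∨ (3 = 3 ∧ n 0 = 2 ∧ n 1 = 2 ∧ n 2 = 2)) → _)
    constructor
    · intro hne
      obtain h1 | ⟨h0, h1, h2⟩ | ⟨h0, h1, h2⟩ | ⟨h0, h1, h2⟩ | ⟨h0, h1⟩ :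
          3 ≤ n 1 ∨ (n 0 = 1 ∧ n 1 = 2 ∧ n 2 = 2) ∨ (n 0 = 1 ∧ n 1 = 2 ∧ n 2 = 3) ∨
            (n 0 = 2 ∧ n 1 = 2 ∧ 3 ≤ n 2) ∨ (n 0 = 1 ∧ n 1 = 1) := by
        omega
      · exact tHolds_four_of_one_three_three n hp h1 (h1.trans h12)
      · exact tHolds_four_one_two_two n h0 h1 h2
      · exact tHolds_four_one_two_three n h0 h1 h2
      · exact tHolds_four_of_two_two_three n h0 h1 h2
      · exact tHolds_four_one_one n h0 h1
    · rintro (⟨-, h0, h1, h2⟩ | ⟨-, h0, h1, h2⟩)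
      · exact tFails_four_one_two_of_four_le n h0 h1 h2
      · exact tFails_four_two_two_two n h0 h1 h2
  · refine ⟨fun _ => ?_, by omega⟩
    have h01 : n 0 ≤ n 1 := mono (by omega : 0 ≤ 1) (by omega)
    have h12 : n 1 ≤ n 2 := mono (by omega : 1 ≤ 2) (by omega)
    have h23 : n 2 ≤ n 3 := mono (by omega : 2 ≤ 3) (by omega)
    have hp : 1 ≤ n 0 := hpos 0
    obtain h2 | ⟨h0, h1, h2, h3⟩ | ⟨h0, h1, h2, h3⟩ | h3 :
        2 ≤ n 2 ∨ (n 0 = 1 ∧ n 1 = 1 ∧ n 2 = 1 ∧ n 3 = 1) ∨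
          (n 0 = 1 ∧ n 1 = 1 ∧ n 2 = 1 ∧ n 3 = 2) ∨ 3 ≤ n 3 := by
      omega
    · exact tHolds_four_of_one_one_two_two n hp (hp.trans h01) h2 (h2.trans h23)
    · exact tHolds_four_one_one_one_one n h0 h1 h2 h3
    · exact tHolds_four_one_one_one_two n h0 h1 h2 h3
    · exact tHolds_four_of_one_one_one_three n hp (by omega) (by omega) h3
  · exact ⟨fun _ => tHolds_four_of_five_le hk5 n hpos, by omega⟩
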